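/- arXiv:gr-qc/0409061 — 3 statements merged into one kernel-verified Lean document; each statement's English description precedes it below -/
import Mathlib

section
/- Let n ≥ 1, let a : ℝ → Mₙ(ℂ) be continuous, and let h : ℝ → Mₙ(ℂ) be differentiable with h(0) = 1 and h′(s) = −a(s)·h(s) for all s ∈ ℝ. Let k : ℝ → Mₙ(ℂ) be differentiable with k(0) = 1 and k′(s) = a(1−s)·k(s) for all s (this is the holonomy ODE for the orientation-reversed path e⁻¹, whose pulled-back connection is −a(1−s)). Then k(1)·h(1) = 1 and h(1)·k(1) = 1; that is, h_{e⁻¹}[A] = h_e[A]⁻¹. -/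
attribute [local instance] Matrix.linftyOpNormedAddCommGroup Matrix.linftyOpNormedSpace

/-- Two solutions of the linear differential equation `y' s = b s * y s` with continuous
coefficient `b` that agree at `0` agree at `1`. -/
theorem eq_at_one_of_hasDerivAt_mul {R : Type*} [NormedRing R] [NormedAlgebra ℝ R]
    {b f g : ℝ → R} (hb : Continuous b) (hf : ∀ s, HasDerivAt f (b s * f s) s)
    (hg : ∀ s, HasDerivAt g (b s * g s) s) (h0 : f 0 = g 0) : f 1 = g 1 := by
  obtain ⟨C, hC⟩ := (isCompact_Icc (a := (0 : ℝ)) (b := 1)).exists_bound_of_continuousOn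
    hb.continuousOn
  have hlip : ∀ t ∈ Set.Ico (0 : ℝ) 1,
      LipschitzOnWith C.toNNReal (fun y => b t * y) Set.univ := by
    intro t ht
    refine (LipschitzWith.of_dist_le_mul fun x y => ?_).lipschitzOnWith
    rw [dist_eq_norm, dist_eq_norm, ← mul_sub]
    refine (norm_mul_le _ _).trans ?_
    gcongr
    exact (hC t (Set.Ico_subset_Icc_self ht)).trans (Real.le_coe_toNNReal C)
  exact ODE_solution_unique_of_mem_Icc_right (v := fun t y => b t * y) hlip
    (fun t _ => (hf t).continuousAt.continuousWithinAt)
    (fun t _ => (hf t).hasDerivWithinAt) (fun _ _ => trivial)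
    (fun t _ => (hg t).continuousAt.continuousWithinAt)
    (fun t _ => (hg t).hasDerivWithinAt) (fun _ _ => trivial) h0
    (Set.right_mem_Icc.mpr zero_le_one)

/-- If `h` solves `h' s = -(a s * h s)` with `h 0 = 1` and `k` solves the reversed equation
`k' s = a (1 - s) * k s` with `k 0 = 1`, then `k 1` is a left inverse of `h 1`. -/
theorem reverse_mul_eq_one_of_hasDerivAt {R : Type*} [NormedRing R] [NormedAlgebra ℝ R]
    {a h k : ℝ → R} (ha : Continuous a)
    (h0 : h 0 = 1) (hderiv : ∀ s, HasDerivAt h (-(a s * h s)) s)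
    (k0 : k 0 = 1) (kderiv : ∀ s, HasDerivAt k (a (1 - s) * k s) s) :
    k 1 * h 1 = 1 := by
  have key := eq_at_one_of_hasDerivAt_mul (b := fun s => a (1 - s))
    (f := fun s => k s * h 1) (g := fun s => h (1 - s)) (by fun_prop)
    (fun s => by simpa only [mul_assoc] using (kderiv s).mul_const (h 1))
    (fun s => by simpa using (hderiv (1 - s)).comp_const_sub 1 s)
    (by simp [k0])
  simpa [h0] using key

/-- The holonomy of the orientation-reversed path is the inverse of the holonomy:
if `h` solves `h' s = -(a s) * h s` with `h 0 = 1` and `k` solves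
`k' s = a (1 - s) * k s` with `k 0 = 1`, then `k 1 * h 1 = 1` and `h 1 * k 1 = 1`. -/
theorem holonomy_reverse_inverse (n : ℕ) (hn : 1 ≤ n)
    (a : ℝ → Matrix (Fin n) (Fin n) ℂ) (ha : Continuous a)
    (h k : ℝ → Matrix (Fin n) (Fin n) ℂ)
    (h0 : h 0 = 1) (hderiv : ∀ s : ℝ, HasDerivAt h (-(a s * h s)) s)
    (k0 : k 0 = 1) (kderiv : ∀ s : ℝ, HasDerivAt k (a (1 - s) * k s) s) :
    k 1 * h 1 = 1 ∧ h 1 * k 1 = 1 := by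
  let _ : NormedRing (Matrix (Fin n) (Fin n) ℂ) := Matrix.linftyOpNormedRing
  let _ : NormedAlgebra ℝ (Matrix (Fin n) (Fin n) ℂ) := Matrix.linftyOpNormedAlgebra
  have hkh : k 1 * h 1 = 1 := reverse_mul_eq_one_of_hasDerivAt ha h0 hderiv k0 kderiv
  exact ⟨hkh, mul_eq_one_comm.mp hkh⟩
end

section
/- Let V be a vector space over ℂ and let X₁, X₂, X₃, Y₁, Y₂, Y₃, Z₁, Z₂, Z₃ be linear endomorphisms of V such that each triple satisfies the su(2) commutation relations [X₁,X₂] = X₃, [X₂,X₃] = X₁, [X₃,X₁] = X₂ (and likewise for the Y's and the Z's), while operators from different triples commute: [X_i, Y_j] = [X_i, Z_j] = [Y_i, Z_j] = 0 for all i, j. If v ∈ V satisfies (X_i + Y_i + Z_i)·v = 0 for i = 1,2,3 (gauge invariance), then Σ_{σ ∈ S₃} sgn(σ) · X_{σ(1)} Y_{σ(2)} Z_{σ(3)} · v = 0, i.e. Σ_{i,j,k} ε_{ijk} X_i Y_j Z_k annihilates v. (Three-valent gauge-invariant spin network nodes are annihilated by the volume operator.) -/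
/-- The antisymmetrized sum over the permutations of three indices, written out. -/
theorem sum_sign_smul_perm_fin_three {M : Type*} [AddCommGroup M]
    (f : Fin 3 → Fin 3 → Fin 3 → M) :
    ∑ σ : Equiv.Perm (Fin 3), (Equiv.Perm.sign σ : ℤ) • f (σ 0) (σ 1) (σ 2) =
      f 0 1 2 - f 0 2 1 - f 1 0 2 + f 1 2 0 + f 2 0 1 - f 2 1 0 := by
  have huniv : (Finset.univ : Finset (Equiv.Perm (Fin 3))) =
      {1, Equiv.swap 1 2, Equiv.swap 0 1, Equiv.swap 0 1 * Equiv.swap 1 2,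
        Equiv.swap 1 2 * Equiv.swap 0 1, Equiv.swap 0 2} := by decide
  rw [huniv, Finset.sum_insert (by decide), Finset.sum_insert (by decide),
    Finset.sum_insert (by decide), Finset.sum_insert (by decide), Finset.sum_insert (by decide),
    Finset.sum_singleton]
  simp [Equiv.swap_apply_def]
  abel

/-- Three-valent gauge-invariant spin network nodes are annihilated by the volume operator:
if `X`, `Y`, `Z` are three mutually commuting copies of the `su(2)` commutation relations
on `V` and `v` is gauge invariant (`(Xᵢ + Yᵢ + Zᵢ) v = 0`), then
`∑_{σ ∈ S₃} sgn(σ) X_{σ(1)} Y_{σ(2)} Z_{σ(3)} v = 0`. -/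
theorem volume_annihilates_three_valent_node {V : Type*} [AddCommGroup V] [Module ℂ V]
    (X Y Z : Fin 3 → Module.End ℂ V)
    (hX : X 0 * X 1 - X 1 * X 0 = X 2 ∧ X 1 * X 2 - X 2 * X 1 = X 0 ∧
      X 2 * X 0 - X 0 * X 2 = X 1)
    (hY : Y 0 * Y 1 - Y 1 * Y 0 = Y 2 ∧ Y 1 * Y 2 - Y 2 * Y 1 = Y 0 ∧
      Y 2 * Y 0 - Y 0 * Y 2 = Y 1)
    (hZ : Z 0 * Z 1 - Z 1 * Z 0 = Z 2 ∧ Z 1 * Z 2 - Z 2 * Z 1 = Z 0 ∧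
      Z 2 * Z 0 - Z 0 * Z 2 = Z 1)
    (hXY : ∀ i j : Fin 3, X i * Y j = Y j * X i)
    (hXZ : ∀ i j : Fin 3, X i * Z j = Z j * X i)
    (hYZ : ∀ i j : Fin 3, Y i * Z j = Z j * Y i)
    (v : V) (hv : ∀ i : Fin 3, (X i + Y i + Z i) v = 0) :
    (∑ σ : Equiv.Perm (Fin 3),
        (Equiv.Perm.sign σ : ℤ) • (X (σ 0) * Y (σ 1) * Z (σ 2))) v = 0 := by
  have hZv (i : Fin 3) : Z i v = -(X i v + Y i v) := by
    have h := hv i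
    simp only [LinearMap.add_apply] at h
    exact eq_neg_of_add_eq_zero_right h
  have hYX (i j : Fin 3) (w : V) : Y j (X i w) = X i (Y j w) :=
    (LinearMap.congr_fun (hXY i j) w).symm
  obtain ⟨hX₀₁, hX₁₂, hX₂₀⟩ := hX
  obtain ⟨hY₀₁, hY₁₂, hY₂₀⟩ := hY
  have apply_commutator {A B C : Module.End ℂ V} (h : A * B - B * A = C) (w : V) :
      A (B w) - B (A w) = C w := LinearMap.congr_fun h w
  have hXX₀₁ := apply_commutator hX₀₁ (Y 2 v)
  have hXX₁₂ := apply_commutator hX₁₂ (Y 0 v)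
  have hXX₂₀ := apply_commutator hX₂₀ (Y 1 v)
  have hYY₀₁ := congrArg (X 2) (apply_commutator hY₀₁ v)
  have hYY₁₂ := congrArg (X 0) (apply_commutator hY₁₂ v)
  have hYY₂₀ := congrArg (X 1) (apply_commutator hY₂₀ v)
  simp only [map_sub] at hYY₀₁ hYY₁₂ hYY₂₀
  rw [sum_sign_smul_perm_fin_three fun i j k => X i * Y j * Z k]
  simp only [LinearMap.add_apply, LinearMap.sub_apply, Module.End.mul_apply, hZv, map_neg, map_add,
    hYX]
  linear_combination (norm := module) hXX₀₁ + hXX₁₂ + hXX₂₀ - hYY₀₁ - hYY₁₂ - hYY₂₀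
end

section
/- Let e be an invertible real 3×3 matrix with entries e(i,a) (internal index i, spatial index a), let K be a real 3×3 matrix with entries K(a,i) (spatial index a, internal index i), define the densitized triad E(a,i) := det(e)·(e⁻¹)(a,i), and define K(a,b) := Σ_i K(a,i)·e(i,b). Then the matrix (K(a,b))_{a,b} is symmetric if and only if for every i one has Σ_{j,k,a} ε(i,j,k)·E(a,j)·K(a,k) = 0, where ε is the Levi-Civita symbol. (The symmetry condition K_{[ab]} = 0 on the extrinsic curvature is equivalent to the Gauss constraint G_i = ε_{ijk} E^{aj} K_a^k = 0 of the triad formulation.) -/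
open Matrix

/-- The Levi-Civita symbol on three indices: `ε i j k` is `1` for even permutations of
`(0,1,2)`, `-1` for odd permutations, `0` otherwise. -/
noncomputable def leviCivita (i j k : Fin 3) : ℝ :=
  ((((j : ℤ) - (i : ℤ)) * ((k : ℤ) - (i : ℤ)) * ((k : ℤ) - (j : ℤ)) : ℤ) : ℝ) / 2

/-- The Levi-Civita contraction of a `3 × 3` matrix vanishes iff the matrix is symmetric. -/
theorem sum_leviCivita_mul_eq_zero_iff (M : Matrix (Fin 3) (Fin 3) ℝ) :
    (∀ i, ∑ j, ∑ k, leviCivita i j k * M j k = 0) ↔ M.IsSymm := by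
  rw [IsSymm.ext_iff]
  simp only [Fin.forall_fin_succ, Fin.sum_univ_succ, leviCivita]
  norm_num [Fin.ext_iff]
  constructor
  · rintro ⟨h0, h1, h2⟩
    refine ⟨⟨?_, ?_⟩, ⟨?_, ?_⟩, ?_, ?_⟩ <;> linarith
  · rintro ⟨⟨h0, h1⟩, ⟨h2, h3⟩, h4, h5⟩
    refine ⟨?_, ?_, ?_⟩ <;> linarith

/-- Congruence by an invertible matrix preserves and reflects symmetry. -/
theorem isSymm_transpose_mul_mul_iff {n R : Type*} [Fintype n] [DecidableEq n] [CommRing R]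
    {P : Matrix n n R} (hP : IsUnit P) (M : Matrix n n R) :
    (Pᵀ * M * P).IsSymm ↔ M.IsSymm := by
  have hPt : IsUnit Pᵀ := (isUnit_transpose P).2 hP
  rw [IsSymm, IsSymm, transpose_mul, transpose_mul, transpose_transpose, ← Matrix.mul_assoc,
    hP.mul_left_inj, hPt.mul_right_inj]

/-- For an invertible triad `e` with densitized triad `E^a_i = det(e) (e⁻¹)^a_i` and
extrinsic-curvature matrix `K_{ab} = K_a^i e^i_b` (i.e. `K * e`), the symmetry
`K_{ab} = K_{ba}` is equivalent to the Gauss constraint `ε_{ijk} E^{aj} K_a^k = 0`. -/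
theorem extrinsic_symmetry_iff_gauss (e E K : Matrix (Fin 3) (Fin 3) ℝ)
    (he : IsUnit e) (hE : ∀ a i : Fin 3, E a i = e.det * e⁻¹ a i) :
    (K * e)ᵀ = K * e ↔
      ∀ i : Fin 3, ∑ j : Fin 3, ∑ k : Fin 3, ∑ a : Fin 3,
        leviCivita i j k * E a j * K a k = 0 := by
  have hdet : IsUnit e.det := (isUnit_iff_isUnit_det e).1 he
  have hEe : E = e.det • e⁻¹ := by
    ext a i
    simp [hE]
  have hcongr : Eᵀ * K = e.det • ((e⁻¹)ᵀ * (K * e) * e⁻¹) := by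
    rw [hEe, transpose_smul, smul_mul, Matrix.mul_assoc, mul_nonsing_inv_cancel_right _ _ hdet]
  have hgauss : ∀ i, ∑ j, ∑ k, ∑ a, leviCivita i j k * E a j * K a k =
      ∑ j, ∑ k, leviCivita i j k * (Eᵀ * K) j k := by
    intro i
    simp only [mul_apply, transpose_apply, Finset.mul_sum, mul_assoc]
  simp only [hgauss]
  rw [sum_leviCivita_mul_eq_zero_iff, hcongr, IsSymm, transpose_smul,
    hdet.smul_left_cancel]
  exact (isSymm_transpose_mul_mul_iff ((isUnit_nonsing_inv_iff).2 he) (K * e)).symm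
end
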